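/- (Nichtnegativstellensatz with degree bound via KKT.) Let h₀, h₁, …, h_l ∈ ℝ[x₁,…,x_n] be polynomials of degree at most d, with d ≥ 2, and set h̄ = (h₀, h₁,…,h_l), h = (h₁,…,h_l). Assume h₀ is non-negative on V(h). Set w := max{d·(c(n+l, d, n+l) − 1), (1/2)·b(n+l, d, l+n+1) + d}. Then there exists σ ∈ Σ²_w[x, λ] (a sum of squares of polynomials in the n + l variables (x, λ), each of degree at most w) such that h₀ − σ vanishes identically on V(h̄_KKT). -/

import Mathlib

open MvPolynomial

/-- `bit(d)`: the number of binary digits of `d`, with `bit(0) = 1`. -/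
def bitNum (d : ℕ) : ℕ := if d = 0 then 1 else Nat.log2 d + 1

/-- The bound `b(n,d,s) = 2^(2^(2^(max{2,d}^(4^n)) + s^(2^n)·max{2,d}^(16^n·bit(d))))`. -/
def bFun (n d s : ℕ) : ℕ :=
  2 ^ 2 ^ (2 ^ (max 2 d) ^ 4 ^ n + s ^ 2 ^ n * (max 2 d) ^ (16 ^ n * bitNum d))

/-- The bound `c(n,d,s) = d(2d-1)^(n+s-1)` on the number of semi-algebraically
path connected components (Coste). -/
def cFun (n d s : ℕ) : ℕ := d * (2 * d - 1) ^ (n + s - 1)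

/-- `σ ∈ Σ²_w`: a finite sum of squares of polynomials of degree at most `w`. -/
def IsSOS {σv : Type*} (w : ℕ) (p : MvPolynomial σv ℝ) : Prop :=
  ∃ (k : ℕ) (q : Fin k → MvPolynomial σv ℝ),
    (∀ i, (q i).totalDegree ≤ w) ∧ p = ∑ i, q i ^ 2

/-- The KKT variety `V(h̄_KKT) ⊆ ℝⁿ × ℝˡ` associated with `h̄ = (h₀, h₁,…,h_l)`. -/
def KKTset {n l : ℕ} (h₀ : MvPolynomial (Fin n) ℝ)
    (h : Fin l → MvPolynomial (Fin n) ℝ) : Set ((Fin n → ℝ) × (Fin l → ℝ)) :=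
  {p | (∀ j, eval p.1 (h j) = 0) ∧
       ∀ i, eval p.1 (pderiv i h₀) = ∑ j, p.2 j * eval p.1 (pderiv i (h j))}


lemma smooth_lift_aux {R K B : Type} [CommRing R] [CommRing K] [CommRing B] [Algebra R K] [Algebra R B]
    [Algebra.FormallySmooth R K] (g : B →+* K) (hc : ∀ r, g (algebraMap R B r) = algebraMap R K r)
    (hg : Function.Surjective g) (hn : ∀ x y, g x = 0 → g y = 0 → x * y = 0) :
    ∃ φ : K →+* B, (∀ a, g (φ a) = a) ∧ ∀ r, φ (algebraMap R K r) = algebraMap R B r := by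
  let g' : B →ₐ[R] K := { g with commutes' := hc }
  have hnil : IsNilpotent (RingHom.ker g') := by
    refine ⟨2, ?_⟩
    rw [pow_two, Ideal.zero_eq_bot, eq_bot_iff, Ideal.mul_le]
    intro x hx y hy
    exact hn x y hx hy
  refine ⟨(Algebra.FormallySmooth.liftOfSurjective (AlgHom.id R K) g' hg hnil : K →ₐ[R] B), ?_, ?_⟩
  · intro a
    exact Algebra.FormallySmooth.liftOfSurjective_apply (AlgHom.id R K) g' hg hnil a
  · intro r
    exact AlgHom.commutes _ r

lemma exists_dual_lift {K : Type} [Field K] [Algebra ℝ K] [Algebra.EssFiniteType ℝ K] (f : K)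
    (hf : Transcendental ℝ f) :
    ∃ φ : K →+* DualNumber K, (∀ a, (φ a).fst = a) ∧ (φ f).snd = 1 ∧
      ∀ r : ℝ, φ (algebraMap ℝ K r) = algebraMap ℝ (DualNumber K) r := by
  let : Algebra (Polynomial ℝ) K := (Polynomial.aeval f).toRingHom.toAlgebra
  have hmap : ∀ p, algebraMap (Polynomial ℝ) K p = Polynomial.aeval f p := fun p => rfl
  have : IsScalarTower ℝ (Polynomial ℝ) K := IsScalarTower.of_algebraMap_eq (fun r => by
    rw [hmap]; simp)
  have : FaithfulSMul (Polynomial ℝ) K := by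
    rw [faithfulSMul_iff_algebraMap_injective]
    exact transcendental_iff_injective.mp hf
  let : Algebra (FractionRing (Polynomial ℝ)) K := FractionRing.liftAlgebra _ _
  have : IsScalarTower (Polynomial ℝ) (FractionRing (Polynomial ℝ)) K :=
    FractionRing.isScalarTower_liftAlgebra _ _
  have : IsScalarTower ℝ (FractionRing (Polynomial ℝ)) K := 
    IsScalarTower.of_algebraMap_eq (fun r => by
      rw [IsScalarTower.algebraMap_apply ℝ (Polynomial ℝ) K,
        IsScalarTower.algebraMap_apply ℝ (Polynomial ℝ) (FractionRing (Polynomial ℝ)),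
        ← IsScalarTower.algebraMap_apply (Polynomial ℝ) (FractionRing (Polynomial ℝ)) K])
  have : Algebra.EssFiniteType (FractionRing (Polynomial ℝ)) K :=
    .of_comp ℝ _ _
  have : CharZero (FractionRing (Polynomial ℝ)) := inferInstance
  have : Algebra.FormallySmooth (FractionRing (Polynomial ℝ)) K := .of_perfectField
  have : Algebra.FormallySmooth (Polynomial ℝ) (FractionRing (Polynomial ℝ)) :=
    .of_isLocalization (nonZeroDivisors _)
  have : Algebra.FormallySmooth (Polynomial ℝ) K := .comp _ (FractionRing (Polynomial ℝ)) _
  let ψ : Polynomial ℝ →ₐ[ℝ] DualNumber K :=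
    Polynomial.aeval (TrivSqZeroExt.inl f + TrivSqZeroExt.inr 1)
  let : Algebra (Polynomial ℝ) (DualNumber K) := ψ.toRingHom.toAlgebra
  have hψ : ∀ p, algebraMap (Polynomial ℝ) (DualNumber K) p = ψ p := fun p => rfl
  obtain ⟨φ, h1, h2⟩ := smooth_lift_aux (R := Polynomial ℝ) (K := K) (B := DualNumber K)
    (TrivSqZeroExt.fstHom ℝ K K).toRingHom (by
      intro r
      rw [hψ, hmap]
      have : (TrivSqZeroExt.fstHom ℝ K K).comp ψ = Polynomial.aeval f := by
        ext; simp [ψ]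
      exact DFunLike.congr_fun this r)
    (fun a => ⟨TrivSqZeroExt.inl a, rfl⟩)
    (by
      intro x y hx hy
      have hx' : x.fst = 0 := hx
      have hy' : y.fst = 0 := hy
      ext <;> simp [hx', hy'])
  refine ⟨φ, h1, ?_, ?_⟩
  · have := h2 Polynomial.X
    rw [hψ, hmap] at this
    simp only [Polynomial.aeval_X, ψ] at this
    rw [this]; simp
  · intro r
    have := h2 (Polynomial.C r)
    rw [hψ, hmap] at this
    simpa [ψ] using this

lemma alg_of_crit {σ : Type} [Fintype σ] (L : MvPolynomial σ ℝ) (P : Ideal (MvPolynomial σ ℝ))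
    [P.IsPrime] (hP : ∀ i, pderiv i L ∈ P) :
    ∃ q : Polynomial ℝ, q ≠ 0 ∧ Polynomial.aeval L q ∈ P := by
  classical
  by_contra! hcon
  let K := P.ResidueField
  have : Algebra.EssFiniteType ℝ K := .comp _ (MvPolynomial σ ℝ) _
  have hker : ∀ a, algebraMap (MvPolynomial σ ℝ) K a = 0 ↔ a ∈ P := fun a =>
    Ideal.algebraMap_residueField_eq_zero
  have htr : Transcendental ℝ (algebraMap (MvPolynomial σ ℝ) K L) := by
    rintro ⟨q, hq, h⟩
    apply hcon q hq
    rw [← hker, ← h]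
    exact (Polynomial.aeval_algebraMap_apply K L q).symm
  obtain ⟨φ, h1, h2, h3⟩ := exists_dual_lift _ htr
  let τ := algebraMap (MvPolynomial σ ℝ) K
  have key : ∀ a, (φ (τ a)).snd = ∑ i, τ (pderiv i a) * (φ (τ (X i))).snd := by
    intro a
    induction a using MvPolynomial.induction_on with
    | C r =>
      have : τ (C r) = algebraMap ℝ K r := 
        (IsScalarTower.algebraMap_apply ℝ (MvPolynomial σ ℝ) K r).symm
      rw [this, h3]
      simp
      rfl
    | add p q hp hq => simp [hp, hq, add_mul, Finset.sum_add_distrib]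
    | mul_X p j hp =>
      simp only [map_mul, TrivSqZeroExt.snd_mul, hp, h1, Derivation.leibniz, pderiv_X, map_add,
        smul_eq_mul, add_mul, Finset.sum_add_distrib, MulOpposite.smul_eq_mul_unop,
        MulOpposite.unop_op]
      congr 1
      · rw [Finset.sum_eq_single j]
        · simp
        · intro b _ hb; simp [hb.symm]
        · simp
      · rw [Finset.sum_mul]
        refine Finset.sum_congr rfl fun i _ => by ring
  have := key L
  rw [h2, Finset.sum_eq_zero] at this
  · exact one_ne_zero this
  · intro i _
    have : τ (pderiv i L) = 0 := (hker _).2 (hP i)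
    rw [this, zero_mul]

lemma crit_finite {σ : Type} [Fintype σ] (L : MvPolynomial σ ℝ) :
    {r : ℝ | ∃ x : σ → ℝ, (∀ i, eval x (pderiv i L) = 0) ∧ eval x L = r}.Finite := by
  classical
  let I : Ideal (MvPolynomial σ ℝ) := Ideal.span (Set.range fun i => pderiv i L)
  have hfin : I.minimalPrimes.Finite := Ideal.finite_minimalPrimes_of_isNoetherianRing _ I
  have hex : ∀ P : Ideal (MvPolynomial σ ℝ), P ∈ I.minimalPrimes →
      ∃ q : Polynomial ℝ, q ≠ 0 ∧ Polynomial.aeval L q ∈ P := by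
    intro P hP
    have := hP.1.1
    exact alg_of_crit L P fun i => hP.1.2 (Ideal.subset_span ⟨i, rfl⟩)
  choose! q hq0 hq using hex
  refine (hfin.biUnion (t := fun P => {r : ℝ | r ∈ (q P).roots}) fun P hP => 
    ((q P).roots.toFinset.finite_toSet).subset fun r hr => by simpa using hr).subset ?_
  rintro r ⟨x, hx, rfl⟩
  have : (RingHom.ker (eval x)).IsPrime := RingHom.ker_isPrime _
  obtain ⟨P, hP, hle⟩ := Ideal.exists_minimalPrimes_le (I := I) (J := RingHom.ker (eval x)) (by
    rw [Ideal.span_le]; rintro _ ⟨i, rfl⟩; exact hx i)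
  simp only [Set.mem_iUnion]
  refine ⟨P, hP, ?_⟩
  have := hle (hq P hP)
  rw [RingHom.mem_ker] at this
  show _ ∈ (q P).roots
  rw [Polynomial.mem_roots (hq0 P hP), Polynomial.IsRoot]
  rw [← this, Polynomial.aeval_def, Polynomial.hom_eval₂]
  rw [Polynomial.eval, ]
  congr 1
  ext; simp

lemma totalDegree_pderiv_le' {σ : Type} (i : σ) (p : MvPolynomial σ ℝ) :
    (pderiv i p).totalDegree ≤ p.totalDegree - 1 := by
  classical
  conv_lhs => rw [p.as_sum, map_sum]
  apply totalDegree_finsetSum_le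
  intro s hs
  rw [pderiv_monomial]
  by_cases h : s i = 0
  · simp [h]
  have h5 : (monomial (s - Finsupp.single i 1) (coeff s p * ↑(s i))).totalDegree ≤
      (s - Finsupp.single i 1).sum (fun _ e => e) := totalDegree_monomial_le _ _
  have h1 := le_totalDegree hs
  have h2 : s = (s - Finsupp.single i 1) + Finsupp.single i 1 := by
    rw [tsub_add_cancel_of_le]
    simpa using Nat.one_le_iff_ne_zero.2 h
  have h3 : s.sum (fun _ e => e) = (s - Finsupp.single i 1).sum (fun _ e => e) + 1 := by
    conv_lhs => rw [h2]
    rw [Finsupp.sum_add_index'] <;> simp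
  omega

lemma card_zeros_le {σ : Type} [Fintype σ] (m : ℕ) (ε : ℝ) (hε : ε ≠ 0)
    (g : σ → MvPolynomial σ ℝ) (hg : ∀ i, (g i).totalDegree < m)
    (S : Finset (σ → ℝ))
    (hS : ∀ x ∈ S, ∀ i, eval x (C ε * X i ^ m + g i) = 0) : S.card ≤ m ^ Fintype.card σ := by
  classical
  let Φ : (S → ℝ) →ₗ[ℝ] ((σ → Fin m) → ℝ) :=
    { toFun := fun c a => ∑ x : S, c x * ∏ i, (x.1 i) ^ (a i : ℕ)
      map_add' := by intro c c'; ext a; simp [add_mul, Finset.sum_add_distrib]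
      map_smul' := by intro c c'; ext a; simp [Finset.mul_sum, mul_assoc] }
  have hinj : Function.Injective Φ := by
    rw [injective_iff_map_eq_zero]
    intro c hc
    have h0 : ∀ N : ℕ, ∀ p : MvPolynomial σ ℝ, p.totalDegree < N →
        ∑ x : S, c x * eval x.1 p = 0 := by
      intro N
      induction N with
      | zero => intro p hp; omega
      | succ N ih =>
        have hmon : ∀ s : σ →₀ ℕ, s.sum (fun _ e => e) ≤ N →
            ∑ x : S, c x * eval x.1 (monomial s (1 : ℝ)) = 0 := by
          intro s hs
          by_cases hbox : ∀ i, s i < m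
          · have := congrFun hc (fun i => ⟨s i, hbox i⟩)
            simp only [Φ, LinearMap.coe_mk, AddHom.coe_mk, Pi.zero_apply] at this
            rw [← this]
            refine Finset.sum_congr rfl fun x _ => ?_
            rw [eval_monomial, one_mul, Finsupp.prod_fintype _ _ (by simp)]
          · push Not at hbox
            obtain ⟨i, hi⟩ := hbox
            have h2 : s = (s - Finsupp.single i m) + Finsupp.single i m := by
              rw [tsub_add_cancel_of_le]
              simpa using hi
            have h3 : s.sum (fun _ e => e) = (s - Finsupp.single i m).sum (fun _ e => e) + m := by
              conv_lhs => rw [h2]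
              rw [Finsupp.sum_add_index'] <;> simp
            set t := s - Finsupp.single i m with ht
            have h4 : (monomial s (1 : ℝ)) = monomial t 1 * X i ^ m := by
              rw [X_pow_eq_monomial, monomial_mul, ← h2, one_mul]
            have h5 : (monomial t (1 : ℝ) * g i).totalDegree < N := by
              refine (totalDegree_mul _ _).trans_lt ?_
              have h8 : (monomial t (1 : ℝ)).totalDegree ≤ t.sum (fun _ e => e) :=
                totalDegree_monomial_le t (1 : ℝ)
              have := hg i
              omega
            have h6 := ih _ h5
            have h7 : ε * ∑ x : S, c x * eval x.1 (monomial s (1 : ℝ)) =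
                - ∑ x : S, c x * eval x.1 (monomial t (1 : ℝ) * g i) := by
              rw [Finset.mul_sum, ← Finset.sum_neg_distrib]
              refine Finset.sum_congr rfl fun x _ => ?_
              have := hS x.1 x.2 i
              rw [map_add, map_mul, eval_C] at this
              rw [h4, map_mul, map_mul]
              linear_combination (c x * eval x.1 (monomial t (1 : ℝ))) * this
            rw [h6, neg_zero] at h7
            exact (mul_eq_zero.1 h7).resolve_left hε
        intro p hp
        have : ∀ x : S, c x * eval x.1 p =
            ∑ s ∈ p.support, coeff s p * (c x * eval x.1 (monomial s (1 : ℝ))) := by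
          intro x
          conv_lhs => rw [p.as_sum, map_sum, Finset.mul_sum]
          refine Finset.sum_congr rfl fun s _ => ?_
          simp only [eval_monomial]; ring
        simp_rw [this]
        rw [Finset.sum_comm]
        refine Finset.sum_eq_zero fun s hs => ?_
        rw [← Finset.mul_sum, hmon s, mul_zero]
        have := le_totalDegree hs
        omega
    have hli := linearIndependent_monoidHom (MvPolynomial σ ℝ) ℝ
    have hinj2 : Function.Injective (fun x : S => ((eval x.1 : MvPolynomial σ ℝ →+* ℝ) : MvPolynomial σ ℝ →* ℝ)) := by
      intro x y hxy
      ext i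
      have := DFunLike.congr_fun hxy (X i)
      simpa using this
    have hli2 := hli.comp _ hinj2
    rw [Fintype.linearIndependent_iff] at hli2
    ext x
    refine hli2 c ?_ x
    ext p
    have := h0 (p.totalDegree + 1) p (Nat.lt_succ_self _)
    simpa using this
  have := LinearMap.finrank_le_finrank_of_injective hinj
  simpa using this

lemma hasDerivAt_eval_update {σ : Type} [Fintype σ] [DecidableEq σ] (p : MvPolynomial σ ℝ) (y : σ → ℝ) (i : σ) :
    HasDerivAt (fun t => eval (Function.update y i t) p) (eval y (pderiv i p)) (y i) := by
  induction p using MvPolynomial.induction_on with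
  | C r => simpa using hasDerivAt_const (y i) r
  | add p q hp hq => 
    simp only [map_add]
    exact HasDerivAt.fun_add hp hq
  | mul_X p j hp =>
    have hX : HasDerivAt (fun t => Function.update y i t j) (if i = j then 1 else 0) (y i) := by
      by_cases h : i = j
      · subst h; simpa using hasDerivAt_id' (y i)
      · simpa [h, Function.update_of_ne (Ne.symm h)] using hasDerivAt_const (y i) (y j)
    have := HasDerivAt.fun_mul hp hX
    simp only [Function.update_eq_self] at this
    have h2 : eval y (pderiv i (p * X j)) = eval y (pderiv i p) * y j + eval y p * (if i = j then 1 else 0) := by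
      rw [Derivation.leibniz, pderiv_X]
      by_cases h : i = j
      · subst h; simp; ring
      · simp [h, mul_comm]
    rw [h2]
    simp only [map_mul, eval_X]
    exact this

lemma pderiv_zero_of_localMin {σ : Type} [Fintype σ] (p : MvPolynomial σ ℝ) (y : σ → ℝ)
    (h : IsLocalMin (fun x => eval x p) y) (i : σ) : eval y (pderiv i p) = 0 := by
  classical
  have hd := hasDerivAt_eval_update p y i
  refine IsLocalMin.hasDerivAt_eq_zero ?_ hd
  have hc : ContinuousAt (fun t => Function.update y i t) (y i) := by fun_prop
  have hc' : Filter.Tendsto (fun t => Function.update y i t) (nhds (y i)) (nhds y) := by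
    simpa [ContinuousAt] using hc
  have := hc'.eventually h
  simpa [IsLocalMin, IsMinFilter] using this

lemma crit_card_le {σ : Type} [Fintype σ] (L : MvPolynomial σ ℝ) (d : ℕ)
    (hL : ∀ i, (pderiv i L).totalDegree ≤ d) (S : Finset ℝ)
    (hS : ∀ r, r ∈ S ↔ ∃ x : σ → ℝ, (∀ i, eval x (pderiv i L) = 0) ∧ eval x L = r) :
    S.card ≤ (2 * d + 1) ^ Fintype.card σ := by
  classical
  have hex : ∀ r, r ∈ S → ∃ x : σ → ℝ, (∀ i, eval x (pderiv i L) = 0) ∧ eval x L = r :=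
    fun r hr => (hS r).1 hr
  choose! x hxc hxL using hex
  -- gap
  obtain ⟨δ, hδ, hgap⟩ : ∃ δ : ℝ, 0 < δ ∧ ∀ r ∈ S, ∀ r' ∈ S, r ≠ r' → 2 * δ ≤ |r - r'| := by
    by_cases hne : S.offDiag.Nonempty
    · obtain ⟨a, ha, hmin⟩ := S.offDiag.exists_min_image (fun a => |a.1 - a.2|) hne
      rw [Finset.mem_offDiag] at ha
      refine ⟨|a.1 - a.2| / 2, ?_, ?_⟩
      · have := abs_pos.2 (sub_ne_zero.2 ha.2.2); linarith
      · intro r hr r' hr' hrr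
        have := hmin (r, r') (Finset.mem_offDiag.2 ⟨hr, hr', hrr⟩)
        simp only at this
        linarith
    · refine ⟨1, one_pos, ?_⟩
      intro r hr r' hr' hrr
      exact absurd ⟨(r, r'), Finset.mem_offDiag.2 ⟨hr, hr', hrr⟩⟩ hne
  let gp : MvPolynomial σ ℝ := ∑ i, X i ^ (2 * d + 2)
  let Q : MvPolynomial σ ℝ := ∑ i, (pderiv i L) ^ 2
  have hgev : ∀ y : σ → ℝ, eval y gp = ∑ i, (y i) ^ (2 * d + 2) := by intro y; simp [gp]
  have hQev : ∀ y : σ → ℝ, eval y Q = ∑ i, (eval y (pderiv i L)) ^ 2 := by intro y; simp [Q]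
  have heven : Even (2 * d + 2) := ⟨d + 1, by ring⟩
  have hg0 : ∀ y : σ → ℝ, 0 ≤ eval y gp := fun y => by
    rw [hgev]; exact Finset.sum_nonneg fun i _ => heven.pow_nonneg _
  have hQ0 : ∀ y : σ → ℝ, 0 ≤ eval y Q := fun y => by
    rw [hQev]; exact Finset.sum_nonneg fun i _ => sq_nonneg _
  obtain ⟨B, hB0, hB⟩ : ∃ B : ℝ, 0 < B ∧ ∀ r ∈ S, eval (x r) gp < B := by
    refine ⟨∑ r ∈ S, eval (x r) gp + 1, ?_, ?_⟩
    · have := Finset.sum_nonneg (s := S) fun r _ => hg0 (x r)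
      linarith
    · intro r hr
      have := Finset.single_le_sum (f := fun r => eval (x r) gp) (fun r _ => hg0 (x r)) hr
      linarith
  have hcont : ∀ p : MvPolynomial σ ℝ, Continuous fun y : σ → ℝ => eval y p := fun p =>
    MvPolynomial.continuous_eval p
  have hcomp : IsCompact {y : σ → ℝ | eval y gp ≤ B} := by
    refine (isCompact_univ_pi (fun _ : σ => isCompact_Icc (a := -(B + 1)) (b := B + 1))).of_isClosed_subset
      (isClosed_le (hcont gp) continuous_const) ?_
    intro y hy
    have hy' : eval y gp ≤ B := hy
    rw [Set.mem_univ_pi]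
    intro i
    have h1 : (y i) ^ (2 * d + 2) ≤ B := by
      refine le_trans ?_ hy'
      rw [hgev]
      exact Finset.single_le_sum (f := fun i => (y i) ^ (2 * d + 2))
        (fun i _ => heven.pow_nonneg _) (Finset.mem_univ i)
    have h2 : |y i| ≤ B + 1 := by
      by_contra hlt
      push Not at hlt
      have h3 : 1 ≤ |y i| := by linarith
      have h4 : |y i| ^ 1 ≤ |y i| ^ (2 * d + 2) := pow_le_pow_right₀ h3 (by omega)
      rw [heven.pow_abs, pow_one] at h4
      linarith
    exact abs_le.1 h2
  -- away from the critical values the gradient is bounded below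
  obtain ⟨η, hη, hηE⟩ : ∃ η : ℝ, 0 < η ∧ ∀ y : σ → ℝ, eval y gp ≤ B →
      (∀ r ∈ S, δ ≤ |eval y L - r|) → η ≤ eval y Q := by
    let E : Set (σ → ℝ) := {y | eval y gp ≤ B} ∩ ⋂ r ∈ S, {y | δ ≤ |eval y L - r|}
    have hEc : IsCompact E := hcomp.inter_right (isClosed_biInter fun r _ =>
      isClosed_le continuous_const (((hcont L).sub continuous_const).abs))
    have hmem : ∀ y : σ → ℝ, eval y gp ≤ B → (∀ r ∈ S, δ ≤ |eval y L - r|) → y ∈ E :=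
      fun y h1 h2 => ⟨h1, Set.mem_iInter₂.2 h2⟩
    rcases E.eq_empty_or_nonempty with hE | hE
    · refine ⟨1, one_pos, fun y h1 h2 => ?_⟩
      have := hmem y h1 h2
      rw [hE] at this
      exact absurd this (Set.notMem_empty _)
    · obtain ⟨z, hz, hmin⟩ := hEc.exists_isMinOn hE (hcont Q).continuousOn
      refine ⟨eval z Q, ?_, fun y h1 h2 => hmin (hmem y h1 h2)⟩
      refine lt_of_le_of_ne (hQ0 z) fun h0 => ?_
      have hz2 : ∀ r ∈ S, δ ≤ |eval z L - r| := Set.mem_iInter₂.1 hz.2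
      have hcrit : ∀ i, eval z (pderiv i L) = 0 := by
        intro i
        rw [hQev] at h0
        have := (Finset.sum_eq_zero_iff_of_nonneg (fun i _ => sq_nonneg _)).1 h0.symm i
          (Finset.mem_univ i)
        exact pow_eq_zero_iff (two_ne_zero) |>.1 this
      have := hz2 _ ((hS _).2 ⟨z, hcrit, rfl⟩)
      simp at this
      linarith
  let ε : ℝ := η / B
  have hε : 0 < ε := div_pos hη hB0
  have hεB : ε * B = η := div_mul_cancel₀ _ hB0.ne'
  let G : MvPolynomial σ ℝ := Q + C ε * gp
  have hGev : ∀ y : σ → ℝ, eval y G = eval y Q + ε * eval y gp := by intro y; simp [G]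
  have hloc : ∀ r, r ∈ S → ∃ y : σ → ℝ, (∀ i, eval y (pderiv i G) = 0) ∧ |eval y L - r| < δ := by
    intro r hr
    have hTc : IsCompact ({y : σ → ℝ | eval y gp ≤ B} ∩ {y | |eval y L - r| ≤ δ}) :=
      hcomp.inter_right (isClosed_le (((hcont L).sub continuous_const).abs) continuous_const)
    have hxT : x r ∈ ({y : σ → ℝ | eval y gp ≤ B} ∩ {y | |eval y L - r| ≤ δ}) := by
      refine ⟨(hB r hr).le, ?_⟩
      show |eval (x r) L - r| ≤ δ
      rw [hxL r hr]; simpa using hδ.le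
    obtain ⟨y, hy, hmin⟩ := hTc.exists_isMinOn ⟨_, hxT⟩ (hcont G).continuousOn
    have hy1 : eval y gp ≤ B := hy.1
    have hy2 : |eval y L - r| ≤ δ := hy.2
    have hle : eval y G ≤ eval (x r) G := hmin hxT
    have hxQ : eval (x r) Q = 0 := by
      rw [hQev]
      exact Finset.sum_eq_zero fun i _ => by rw [hxc r hr i]; simp
    have hxlt : ε * eval (x r) gp < ε * B := mul_lt_mul_of_pos_left (hB r hr) hε
    rw [hGev, hGev, hxQ, zero_add] at hle
    have hgy : eval y gp < B := by
      have := hQ0 y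
      exact lt_of_mul_lt_mul_left (by linarith) hε.le
    have hLy : |eval y L - r| < δ := by
      refine lt_of_le_of_ne hy2 fun heq => ?_
      have hge := hηE y hy1 (by
        intro r' hr'
        by_cases h : r = r'
        · rw [← h, heq]
        · have h1 := hgap r hr r' hr' h
          have h2 : |r - r'| ≤ |eval y L - r| + |eval y L - r'| := by
            have := abs_sub_le r (eval y L) r'
            rwa [abs_sub_comm r (eval y L)] at this
          linarith)
      have := mul_nonneg hε.le (hg0 y)
      linarith
    refine ⟨y, ?_, hLy⟩
    have hopen : {z : σ → ℝ | eval z gp < B} ∩ {z | |eval z L - r| < δ} ∈ nhds y :=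
      IsOpen.mem_nhds ((isOpen_lt (hcont gp) continuous_const).inter
        (isOpen_lt (((hcont L).sub continuous_const).abs) continuous_const)) ⟨hgy, hLy⟩
    apply pderiv_zero_of_localMin
    filter_upwards [hopen] with z hz
    have hz1 : eval z gp < B := hz.1
    have hz2 : |eval z L - r| < δ := hz.2
    exact hmin ⟨hz1.le, hz2.le⟩
  choose! y hyc hyL using hloc
  have hinj : Set.InjOn y S := by
    intro r hr r' hr' heq
    by_contra hne
    have h1 := hgap r hr r' hr' hne
    have h2 := hyL r hr
    have h3 := hyL r' hr'
    rw [← heq] at h3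
    have h4 := abs_sub_le r (eval (y r) L) r'
    rw [abs_sub_comm r (eval (y r) L)] at h4
    linarith
  rw [← Finset.card_image_of_injOn hinj]
  have hQdeg : Q.totalDegree ≤ 2 * d := by
    apply totalDegree_finsetSum_le
    intro i _
    refine (totalDegree_pow _ _).trans ?_
    have := hL i
    omega
  refine card_zeros_le (2 * d + 1) (ε * (2 * d + 2)) (by positivity) (fun i => pderiv i Q) ?_ _ ?_
  · intro i
    have := totalDegree_pderiv_le' i Q
    show (pderiv i Q).totalDegree < _
    omega
  · intro z hz i
    obtain ⟨r, hr, rfl⟩ := Finset.mem_image.1 hz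
    have h1 := hyc r hr i
    have h2 : eval (y r) (pderiv i gp) = (2 * d + 2) * (y r i) ^ (2 * d + 1) := by
      simp only [gp, map_sum]
      rw [Finset.sum_eq_single i]
      · rw [Derivation.leibniz_pow, pderiv_X_self]
        simp
      · intro j _ hj
        rw [Derivation.leibniz_pow, pderiv_X_of_ne hj]
        simp
      · simp
    simp only [G, map_add, pderiv_C_mul, map_mul, eval_C, h2] at h1
    simp only [map_add, map_mul, eval_C, eval_X, map_pow]
    linarith

lemma totalDegree_aeval_le' {τ : Type} (q : Polynomial ℝ) (p : MvPolynomial τ ℝ) (k d : ℕ)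
    (hq : q.natDegree ≤ k) (hp : p.totalDegree ≤ d) :
    (Polynomial.aeval p q).totalDegree ≤ d * k := by
  rw [Polynomial.aeval_eq_sum_range]
  apply totalDegree_finsetSum_le
  intro i hi
  refine (totalDegree_smul_le _ _).trans ((totalDegree_pow _ _).trans ?_)
  have : i ≤ k := by
    have := Finset.mem_range.1 hi
    omega
  rw [mul_comm d k]
  exact Nat.mul_le_mul this hp

lemma bound_le (N d : ℕ) (hd : 2 ≤ d) : (2 * d + 1) ^ N ≤ cFun N d N := by
  unfold cFun
  obtain ⟨e, rfl⟩ : ∃ e, d = e + 2 := ⟨d - 2, by omega⟩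
  have h1 : 2 * (e + 2) - 1 = 2 * e + 3 := by omega
  rw [h1]
  rcases N with _ | N
  · simp
  have h2 : N + 1 + (N + 1) - 1 = 2 * N + 1 := by omega
  rw [h2, pow_succ, pow_succ, pow_mul]
  have h3 : (2 * (e + 2) + 1) ^ N ≤ ((2 * e + 3) ^ 2) ^ N := Nat.pow_le_pow_left (by nlinarith) _
  have h4 : 2 * (e + 2) + 1 ≤ (e + 2) * (2 * e + 3) := by nlinarith
  calc _ ≤ ((2 * e + 3) ^ 2) ^ N * ((e + 2) * (2 * e + 3)) := Nat.mul_le_mul h3 h4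
    _ = _ := by ring

/-- **Theorem 2.21(2) (Nichtnegativstellensatz with degree bound via KKT).**
If `h₀, h₁, …, h_l` have degree at most `d ≥ 2` and `h₀` is non-negative on
`V(h)`, then with `w = max{d(c(n+l,d,n+l)-1), b(n+l,d,l+n+1)/2 + d}` there is a
sum of squares `σ ∈ Σ²_w[x,λ]` such that `h₀ - σ` vanishes on `V(h̄_KKT)`. -/
theorem stmt_13 {n l : ℕ} (d : ℕ) (hd : 2 ≤ d)
    (h₀ : MvPolynomial (Fin n) ℝ) (h : Fin l → MvPolynomial (Fin n) ℝ)
    (hdeg₀ : h₀.totalDegree ≤ d) (hdeg : ∀ j, (h j).totalDegree ≤ d)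
    (hnonneg : ∀ x : Fin n → ℝ, (∀ j, eval x (h j) = 0) → 0 ≤ eval x h₀)
    (w : ℕ)
    (hw : w = max (d * (cFun (n + l) d (n + l) - 1))
              (bFun (n + l) d (l + n + 1) / 2 + d)) :
    ∃ σ : MvPolynomial (Fin n ⊕ Fin l) ℝ, IsSOS w σ ∧
      ∀ p ∈ KKTset h₀ h, eval p.1 h₀ = eval (Sum.elim p.1 p.2) σ := by
  classical
  let L : MvPolynomial (Fin n ⊕ Fin l) ℝ :=
    rename Sum.inl h₀ - ∑ j, X (Sum.inr j) * rename Sum.inl (h j)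
  have hdX : ∀ (i : Fin n) (p : MvPolynomial (Fin n) ℝ),
      pderiv (Sum.inl i : Fin n ⊕ Fin l) (rename Sum.inl p) = rename Sum.inl (pderiv i p) :=
    fun i p => pderiv_rename Sum.inl_injective i p
  have hdr : ∀ (j : Fin l) (p : MvPolynomial (Fin n) ℝ),
      pderiv (Sum.inr j : Fin n ⊕ Fin l) (rename Sum.inl p) = 0 := by
    intro j p
    apply pderiv_eq_zero_of_notMem_vars
    intro hmem
    have := vars_rename (Sum.inl : Fin n → Fin n ⊕ Fin l) p hmem
    simp at this
  have hev : ∀ (a : Fin n → ℝ) (b : Fin l → ℝ) (p : MvPolynomial (Fin n) ℝ),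
      eval (Sum.elim a b) (rename Sum.inl p) = eval a p := by
    intro a b p
    rw [eval_rename]; rfl
  have hLdeg : L.totalDegree ≤ d + 1 := by
    refine (totalDegree_sub _ _).trans (max_le ?_ ?_)
    · exact (totalDegree_rename_le _ _).trans (by omega)
    · apply totalDegree_finsetSum_le
      intro j _
      refine (totalDegree_mul _ _).trans ?_
      have h1 := (totalDegree_rename_le (Sum.inl : Fin n → Fin n ⊕ Fin l) (h j)).trans (hdeg j)
      rw [totalDegree_X]
      omega
  have hLd : ∀ i, (pderiv i L).totalDegree ≤ d := by
    intro i
    have := totalDegree_pderiv_le' i L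
    omega
  -- KKT points are critical points of the Lagrangian
  have hcritL : ∀ p ∈ KKTset h₀ h, (∀ i, eval (Sum.elim p.1 p.2) (pderiv i L) = 0) ∧
      eval (Sum.elim p.1 p.2) L = eval p.1 h₀ := by
    rintro ⟨a, b⟩ ⟨h1, h2⟩
    simp only at h1 h2 ⊢
    refine ⟨?_, ?_⟩
    · rintro (i | j)
      · simp only [L, map_sub, map_sum, Derivation.leibniz, hdX, smul_eq_mul, map_add, map_mul,
          hev, eval_X, h1, h2 i, Sum.elim_inr]
        simp
      · simp only [L, map_sub, map_sum, Derivation.leibniz, hdr, smul_eq_mul, map_add, map_mul,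
          hev, eval_X, h1, Sum.elim_inr]
        simp
    · simp [L, hev, h1]
  let S : Finset ℝ := (crit_finite L).toFinset
  have hS : ∀ r, r ∈ S ↔ ∃ x : Fin n ⊕ Fin l → ℝ,
      (∀ i, eval x (pderiv i L) = 0) ∧ eval x L = r := by
    intro r
    simp [S]
  have hcard : S.card ≤ cFun (n + l) d (n + l) := by
    have := crit_card_le L d hLd S hS
    simp only [Fintype.card_sum, Fintype.card_fin] at this
    exact this.trans (bound_le _ _ hd)
  let q : Polynomial ℝ := Lagrange.interpolate S id (fun r => Real.sqrt r)
  have hqdeg : q.natDegree ≤ cFun (n + l) d (n + l) - 1 := by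
    have h1 : q.degree < S.card := Lagrange.degree_interpolate_lt _ (Set.injOn_id _)
    by_cases hq : q = 0
    · simp [hq]
    · have := (Polynomial.natDegree_lt_iff_degree_lt hq).2 h1
      omega
  have hqev : ∀ r ∈ S, q.eval r = Real.sqrt r := fun r hr =>
    Lagrange.eval_interpolate_at_node (v := id) _ (Set.injOn_id _) hr
  refine ⟨(Polynomial.aeval (rename Sum.inl h₀) q) ^ 2,
    ⟨1, fun _ => Polynomial.aeval (rename Sum.inl h₀) q, ?_, by simp⟩, ?_⟩
  · intro _
    have := totalDegree_aeval_le' q (rename (Sum.inl : Fin n → Fin n ⊕ Fin l) h₀) _ d hqdeg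
      ((totalDegree_rename_le _ _).trans hdeg₀)
    exact this.trans (hw ▸ le_max_left _ _)
  · intro p hp
    obtain ⟨h1, h2⟩ := hcritL p hp
    have hmem : eval p.1 h₀ ∈ S := (hS _).2 ⟨_, h1, h2⟩
    have h3 : eval (Sum.elim p.1 p.2) (Polynomial.aeval (rename Sum.inl h₀) q) =
        q.eval (eval p.1 h₀) := by
      rw [← hev p.1 p.2 h₀, Polynomial.aeval_def, Polynomial.hom_eval₂, Polynomial.eval]
      congr 1
      ext; simp
    rw [map_pow, h3, hqev _ hmem, Real.sq_sqrt (hnonneg _ hp.1)]
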